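/- Let G be a labelled graph on d ≥ 1 vertices and let v = d be its last vertex. Suppose c_{(λ,b)} are rational numbers, indexed by the pairs (λ,b) of an integer partition λ and an integer b ≥ 1 with |λ| + b = d, and π_{(λ,b)} are set partitions of {1,…,d} with type(π_{(λ,b)}) = (λ,b), such that Y_G − Σ_{(λ,b)} c_{(λ,b)} e_{π_{(λ,b)}} ∈ K_d. Then for every integer j ≥ 1, the number of acyclic orientations of G having exactly j sinks, one of which is the vertex v, equals Σ_{(λ,b) : ℓ(λ)+1 = j} c_{(λ,b)} · λ! · (b−1)!, where ℓ(λ) is the number of parts of λ and λ! = λ_1!⋯λ_{ℓ(λ)}!. -/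

import Mathlib

open scoped Classical
noncomputable section

/-- Words of length `d` in the positive integers. -/
abbrev NCWord (d : ℕ) := Fin d → ℕ+

/-- `M_d`: coefficient functions of homogeneous degree-`d` series in
noncommuting variables. -/
abbrev Md (d : ℕ) := NCWord d → ℚ

/-- `Y_G`, the chromatic symmetric function of a labelled graph in
noncommuting variables, as an element of `M_d`. -/
def YG {d : ℕ} (G : SimpleGraph (Fin d)) : Md d :=
  fun w => if ∀ j k : Fin d, G.Adj j k → w j ≠ w k then 1 else 0

/-- Set partitions of `{0, …, d-1}`. -/
abbrev SetPtn (d : ℕ) := Finpartition (Finset.univ : Finset (Fin d))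

/-- `j` and `k` lie in a common block of `π`. -/
def sameBlock {d : ℕ} (π : SetPtn d) (j k : Fin d) : Prop :=
  ∃ B ∈ π.parts, j ∈ B ∧ k ∈ B

/-- The elementary symmetric function `e_π` in noncommuting variables. -/
def eSP {d : ℕ} (π : SetPtn d) : Md d :=
  fun w => if ∀ j k : Fin d, j ≠ k → sameBlock π j k → w j ≠ w k then 1 else 0

/-- The block of `π` containing `a`. -/
def blockOf {d : ℕ} (π : SetPtn d) (a : Fin d) : Finset (Fin d) :=
  Finset.univ.filter fun k => sameBlock π a k

/-- The type of a set partition relative to the distinguished element `a`: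
the multiset of sizes of the blocks not containing `a` (an integer partition),
together with the size of the block containing `a`. -/
def ptype {d : ℕ} (π : SetPtn d) (a : Fin d) : Multiset ℕ × ℕ :=
  ((π.parts.erase (blockOf π a)).val.map Finset.card, (blockOf π a).card)

/-- `K_d`: the span of the differences `e_{π₁} - e_{π₂}` over pairs of set
partitions of equal type (relative to the distinguished element `a`). -/
def Ksub {d : ℕ} (a : Fin d) : Submodule ℚ (Md d) :=
  Submodule.span ℚ
    {f | ∃ π₁ π₂ : SetPtn d, ptype π₁ a = ptype π₂ a ∧ f = eSP π₁ - eSP π₂}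

/-- `(e)`-positivity of a labelled graph, with distinguished vertex `a`:
`Y_G` is congruent modulo `K_d` to a nonnegative combination of `e_π`'s. -/
def IsEPosNCAt {d : ℕ} (G : SimpleGraph (Fin d)) (a : Fin d) : Prop :=
  ∃ (s : Finset (SetPtn d)) (c : SetPtn d → ℚ),
    (∀ π, 0 ≤ c π) ∧ YG G - ∑ π ∈ s, c π • eSP π ∈ Ksub a

/-- Induction `↑ : M_d → M_{d+1}`. -/
def induct {d : ℕ} (f : Md d) : Md (d + 1) :=
  fun w => if w (Fin.last d) = w ⟨d - 1, by omega⟩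
    then f (fun t => w t.castSucc) else 0

/-- Concatenation of labelled graphs: identify the last vertex of `G` with
the first vertex of `H`. -/
def concatG {p q : ℕ} (G : SimpleGraph (Fin p)) (H : SimpleGraph (Fin q)) :
    SimpleGraph (Fin (p + q - 1)) :=
  SimpleGraph.fromRel fun a b =>
    (∃ i j : Fin p, G.Adj i j ∧ (a : ℕ) = (i : ℕ) ∧ (b : ℕ) = (j : ℕ)) ∨
    (∃ i j : Fin q, H.Adj i j ∧ (a : ℕ) = (i : ℕ) + (p - 1) ∧ (b : ℕ) = (j : ℕ) + (p - 1))

/-- The reverse graph `G^r`. -/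
def revG {d : ℕ} (G : SimpleGraph (Fin d)) : SimpleGraph (Fin d) :=
  SimpleGraph.comap (fun i : Fin d => (⟨d - 1 - (i : ℕ), by have := i.isLt; omega⟩ : Fin d)) G

/-- A labelled graph: a simple graph on vertex set `{0, …, n-1}`, `n ≥ 1`. -/
structure LGraph where
  n : ℕ
  npos : 0 < n
  G : SimpleGraph (Fin n)

/-- The last vertex of a labelled graph. -/
def LGraph.last (A : LGraph) : Fin A.n := ⟨A.n - 1, by have := A.npos; omega⟩

/-- A labelled graph is `(e)`-positive (at its last vertex). -/
def LGraph.EPosNC (A : LGraph) : Prop := IsEPosNCAt A.G A.last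

/-- Concatenation, as an operation on labelled graphs. -/
def LGraph.concat (A B : LGraph) : LGraph :=
  ⟨A.n + B.n - 1, by have := A.npos; have := B.npos; omega, concatG A.G B.G⟩

/-- Reversal, as an operation on labelled graphs. -/
def LGraph.rev (A : LGraph) : LGraph := ⟨A.n, A.npos, revG A.G⟩

/-- Appendable `(e)`-positivity: `G + H` is `(e)`-positive for every
`(e)`-positive labelled graph `G`. -/
def LGraph.Appendable (H : LGraph) : Prop :=
  ∀ A : LGraph, A.EPosNC → (A.concat H).EPosNC

/-- The chromatic symmetric polynomial of `G` in `n` commuting variables. -/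
def cspoly {V : Type} [Fintype V] [DecidableEq V] (G : SimpleGraph V) (n : ℕ) :
    MvPolynomial (Fin n) ℚ :=
  ∑ κ ∈ Finset.univ.filter (fun κ : V → Fin n => ∀ u v : V, G.Adj u v → κ u ≠ κ v),
    ∏ v : V, MvPolynomial.X (κ v)

/-- `e`-positivity of a finite graph. -/
def EPos {V : Type} [Fintype V] [DecidableEq V] (G : SimpleGraph V) : Prop :=
  ∃ c : Nat.Partition (Fintype.card V) → ℚ, (∀ p, 0 ≤ c p) ∧
    ∀ n : ℕ, cspoly G n =
      ∑ p : Nat.Partition (Fintype.card V),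
        c p • (p.parts.map fun r => MvPolynomial.esymm (Fin n) ℚ r).prod

/-- Closed neighbourhood of a vertex, as a finset. -/
def closedNbhd {d : ℕ} (G : SimpleGraph (Fin d)) (i : Fin d) : Finset (Fin d) :=
  Finset.univ.filter fun k => k = i ∨ G.Adj i k

/-- `m_i`: the largest label in the closed neighbourhood of `i`. -/
def mIdx {d : ℕ} (G : SimpleGraph (Fin d)) (i : Fin d) : Fin d :=
  (closedNbhd G i).max' ⟨i, by simp [closedNbhd]⟩

/-- `w_i`: the smallest label in the closed neighbourhood of `i`. -/
def wIdx {d : ℕ} (G : SimpleGraph (Fin d)) (i : Fin d) : Fin d :=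
  (closedNbhd G i).min' ⟨i, by simp [closedNbhd]⟩

/-- Labelled unit interval graph. -/
def IsUnitInterval {d : ℕ} (G : SimpleGraph (Fin d)) : Prop :=
  ∀ i v w j : Fin d, i ≤ v → v < w → w ≤ j → G.Adj i j → G.Adj v w

/-- An acyclic orientation of a graph, as an asymmetric relation with
irreflexive transitive closure whose symmetrization matches adjacency. -/
def IsAcyclicOrientation {V : Type} (G : SimpleGraph V) (r : V → V → Prop) : Prop :=
  (∀ a b, r a b → ¬ r b a) ∧
  (∀ a b, a ≠ b → ((r a b ∨ r b a) ↔ G.Adj a b)) ∧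
  Irreflexive (Relation.TransGen r)

/-- The set of sinks of an orientation. -/
def sinkSet {V : Type} [Fintype V] (r : V → V → Prop) : Finset V :=
  Finset.univ.filter fun x => ∀ y, ¬ r x y

/-- The labelled path `P_d`. -/
def PathG (d : ℕ) : SimpleGraph (Fin d) :=
  SimpleGraph.fromRel fun a b => (b : ℕ) = (a : ℕ) + 1

/-- The labelled cycle `C_d`. -/
def CycleG (d : ℕ) : SimpleGraph (Fin d) :=
  SimpleGraph.fromRel fun a b => (b : ℕ) = (a : ℕ) + 1 ∨ ((a : ℕ) = 0 ∧ (b : ℕ) = d - 1)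

section AcyclicOrientations

variable {V : Type}

theorem IsAcyclicOrientation.adj {G : SimpleGraph V} {r : V → V → Prop}
    (h : IsAcyclicOrientation G r) {a b : V} (hab : r a b) : G.Adj a b := by
  have hne : a ≠ b := by
    rintro rfl
    exact h.1 a a hab hab
  exact (h.2.1 a b hne).1 (Or.inl hab)

theorem IsAcyclicOrientation.rel_or_rel {G : SimpleGraph V} {r : V → V → Prop}
    (h : IsAcyclicOrientation G r) {a b : V} (hab : G.Adj a b) : r a b ∨ r b a :=
  (h.2.1 a b hab.ne).2 hab

/-- The spanning subgraph of `G` consisting of the edges with both ends in `U`. -/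
def restrictEdges (G : SimpleGraph V) (U : Finset V) : SimpleGraph V where
  Adj a b := G.Adj a b ∧ a ∈ U ∧ b ∈ U
  symm := ⟨fun _ _ h => ⟨h.1.symm, h.2.2, h.2.1⟩⟩
  loopless := ⟨fun _ h => h.1.ne rfl⟩

theorem restrictEdges_empty (G : SimpleGraph V) : restrictEdges G ∅ = ⊥ := by
  ext a b
  simp [restrictEdges]

variable [Fintype V]

theorem mem_sinkSet {r : V → V → Prop} {x : V} : x ∈ sinkSet r ↔ ∀ y, ¬ r x y := by
  simp [sinkSet]

/-- Every nonempty union of connected components contains a sink. -/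
theorem IsAcyclicOrientation.exists_mem_sinkSet {G : SimpleGraph V} {r : V → V → Prop}
    (h : IsAcyclicOrientation G r) {W : Finset V} (hW : W.Nonempty)
    (hclosed : ∀ x ∈ W, ∀ y, G.Adj x y → y ∈ W) : ∃ x ∈ W, x ∈ sinkSet r := by
  have : Std.Irrefl (flip (Relation.TransGen r)) := ⟨fun a => h.2.2 a⟩
  have : IsTrans V (flip (Relation.TransGen r)) := ⟨fun _ _ _ hab hbc => hbc.trans hab⟩
  have hwf : WellFounded (flip (Relation.TransGen r)) := Finite.wellFounded_of_trans_of_irrefl _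
  obtain ⟨x, hx, hmin⟩ := hwf.has_min (W : Set V) (by simpa using hW)
  refine ⟨x, hx, mem_sinkSet.2 fun y hxy => ?_⟩
  exact hmin y (hclosed x hx y (h.adj hxy)) (Relation.TransGen.single hxy)

theorem restrictEdges_univ (G : SimpleGraph V) : restrictEdges G Finset.univ = G := by
  ext a b
  simp [restrictEdges]

variable [DecidableEq V]

/-- The finite set of acyclic orientations of a graph. -/
def acyclicOrientations (G : SimpleGraph V) : Finset (V → V → Prop) :=
  Finset.univ.filter (IsAcyclicOrientation G)

theorem mem_acyclicOrientations {G : SimpleGraph V} {r : V → V → Prop} :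
    r ∈ acyclicOrientations G ↔ IsAcyclicOrientation G r := by
  simp [acyclicOrientations]

theorem restrictEdges_restrictEdges_compl (G : SimpleGraph V) (U S : Finset V) :
    restrictEdges (restrictEdges G U) Sᶜ = restrictEdges G (U \ S) := by
  ext a b
  simp only [restrictEdges, Finset.mem_compl, Finset.mem_sdiff]
  tauto

theorem acyclicOrientations_bot : (acyclicOrientations (⊥ : SimpleGraph V)).card = 1 := by
  rw [Finset.card_eq_one]
  refine ⟨fun _ _ => False, ?_⟩
  ext r
  rw [mem_acyclicOrientations, Finset.mem_singleton]
  constructor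
  · intro h
    funext a b
    exact eq_false fun hab => h.adj hab
  · rintro rfl
    refine ⟨fun _ _ h => h.elim, fun a b _ => by simp, fun a h => ?_⟩
    obtain ⟨_, hf, _⟩ := Relation.TransGen.head'_iff.1 h
    exact hf

/-- Acyclic orientations in which every vertex of a stable set `S` is a sink correspond to
acyclic orientations of the graph with the edges at `S` removed. -/
theorem card_filter_subset_sinkSet (G : SimpleGraph V) (S : Finset V)
    (hS : ∀ a ∈ S, ∀ b ∈ S, ¬ G.Adj a b) :
    ((acyclicOrientations G).filter fun r => S ⊆ sinkSet r).card =
      (acyclicOrientations (restrictEdges G Sᶜ)).card := by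
  refine Finset.card_bij' (fun r _ a b => r a b ∧ b ∉ S) (fun q _ a b => q a b ∨ (G.Adj a b ∧ b ∈ S))
    ?_ ?_ ?_ ?_
  · intro r hr
    rw [Finset.mem_filter, mem_acyclicOrientations] at hr
    obtain ⟨hr, hsink⟩ := hr
    have hout : ∀ a b, r a b → a ∉ S := fun a b hab ha => mem_sinkSet.1 (hsink ha) b hab
    rw [mem_acyclicOrientations]
    refine ⟨fun a b hab hba => hr.1 a b hab.1 hba.1, fun a b hne => ?_, fun a h => ?_⟩
    · have h1 := hr.2.1 a b hne
      have h2 := hout a b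
      have h3 := hout b a
      simp only [restrictEdges, Finset.mem_compl]
      tauto
    · exact hr.2.2 a (h.lift id fun _ _ h => h.1)
  · intro q hq
    rw [mem_acyclicOrientations] at hq
    have hqS : ∀ a b, q a b → a ∉ S ∧ b ∉ S := fun a b hab => by
      have := hq.adj hab
      simpa [restrictEdges] using this.2
    have hout : ∀ a b, (q a b ∨ (G.Adj a b ∧ b ∈ S)) → a ∉ S := by
      rintro a b (hab | hab) ha
      · exact (hqS a b hab).1 ha
      · exact hS a ha b hab.2 hab.1
    rw [Finset.mem_filter, mem_acyclicOrientations]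
    refine ⟨⟨fun a b hab hba => ?_, fun a b hne => ?_, fun a h => ?_⟩, fun a ha => ?_⟩
    · have h1 := hout a b hab
      have h2 := hout b a hba
      have h3 := hq.1 a b
      tauto
    · have h1 := hq.2.1 a b hne
      have h2 := hS a
      have h3 : G.Adj b a ↔ G.Adj a b := G.adj_comm b a
      simp only [restrictEdges, Finset.mem_compl] at h1
      tauto
    · have key : ∀ b, Relation.TransGen (fun a b => q a b ∨ (G.Adj a b ∧ b ∈ S)) a b →
          Relation.TransGen q a b ∨ b ∈ S := by
        intro b hb
        induction hb with
        | single h =>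
          exact h.imp Relation.TransGen.single And.right
        | tail _ h ih =>
          exact h.imp (fun hbc => (ih.resolve_right (hout _ _ h)).tail hbc) And.right
      obtain ⟨c, hc, _⟩ := Relation.TransGen.head'_iff.1 h
      exact hq.2.2 a ((key a h).resolve_right (hout _ _ hc))
    · exact mem_sinkSet.2 fun b hab => hout a b hab ha
  · intro r hr
    rw [Finset.mem_filter, mem_acyclicOrientations] at hr
    obtain ⟨hr, hsink⟩ := hr
    funext a b
    refine propext ⟨?_, fun hab => ?_⟩
    · rintro (h | ⟨hab, hb⟩)
      · exact h.1
      · exact (hr.rel_or_rel hab).resolve_right (mem_sinkSet.1 (hsink hb) a)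
    · have := hr.adj hab
      tauto
  · intro q hq
    rw [mem_acyclicOrientations] at hq
    funext a b
    refine propext ⟨fun h => ?_, fun hab => ?_⟩
    · exact h.1.resolve_right fun h' => h.2 h'.2
    · have := hq.adj hab
      simp only [restrictEdges, Finset.mem_compl] at this
      tauto

theorem card_filter_subset_sinkSet_eq_zero (G : SimpleGraph V) (S : Finset V)
    (hS : ¬ ∀ a ∈ S, ∀ b ∈ S, ¬ G.Adj a b) :
    ((acyclicOrientations G).filter fun r => S ⊆ sinkSet r).card = 0 := by
  push Not at hS
  obtain ⟨a, ha, b, hb, hab⟩ := hS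
  rw [Finset.card_eq_zero, Finset.filter_eq_empty_iff]
  intro r hr hsink
  rcases (mem_acyclicOrientations.1 hr).rel_or_rel hab with h | h
  · exact mem_sinkSet.1 (hsink ha) b h
  · exact mem_sinkSet.1 (hsink hb) a h

end AcyclicOrientations

section LinearInvariants

variable {d : ℕ}

/-- The graph invariants that factor through a linear functional of `Y_G`. -/
def linearInvariants (d : ℕ) : Submodule ℚ (SimpleGraph (Fin d) → ℚ) :=
  LinearMap.range (LinearMap.pi (fun G => LinearMap.applyₗ (YG G)) :
    (Md d →ₗ[ℚ] ℚ) →ₗ[ℚ] (SimpleGraph (Fin d) → ℚ))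

theorem mem_linearInvariants {F : SimpleGraph (Fin d) → ℚ} :
    F ∈ linearInvariants d ↔ ∃ L : Md d →ₗ[ℚ] ℚ, ∀ G, L (YG G) = F G := by
  simp [linearInvariants, LinearMap.mem_range, funext_iff]

/-- The word `w` properly colours the subgraph of `G` induced on the complement of `U`. -/
def ProperOff (w : NCWord d) (U : Finset (Fin d)) (G : SimpleGraph (Fin d)) : Prop :=
  ∀ a b, a ∉ U → b ∉ U → G.Adj a b → w a ≠ w b

/-- The number of acyclic orientations of `G` restricted to `U`, provided that `w` is proper
outside of `U`. -/
def countOn (U : Finset (Fin d)) (w : NCWord d) (G : SimpleGraph (Fin d)) : ℚ :=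
  if ProperOff w U G then ((acyclicOrientations (restrictEdges G U)).card : ℚ) else 0

/-- As `countOn`, counting only orientations whose sinks in `U` form the set `T`. -/
def countSinksOn (U : Finset (Fin d)) (w : NCWord d) (T : Finset (Fin d))
    (G : SimpleGraph (Fin d)) : ℚ :=
  if ProperOff w U G then
    (((acyclicOrientations (restrictEdges G U)).filter fun r => U ∩ sinkSet r = T).card : ℚ) else 0

theorem exists_fresh (w : NCWord d) : ∃ n : ℕ+, ∀ a, w a ≠ n := by
  obtain ⟨n, hn⟩ := Infinite.exists_notMem_finset (Finset.univ.image w)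
  exact ⟨n, fun a ha => hn (by simp [← ha])⟩

theorem properOff_sdiff {w : NCWord d} {n : ℕ+} (hn : ∀ a, w a ≠ n) {U S : Finset (Fin d)}
    (hSU : S ⊆ U) (G : SimpleGraph (Fin d)) :
    ProperOff (fun a => if a ∈ S then n else w a) (U \ S) G ↔
      ProperOff w U G ∧ ∀ a ∈ S, ∀ b ∈ S, ¬ G.Adj a b := by
  constructor
  · intro h
    refine ⟨fun a b ha hb hab => ?_, fun a ha b hb hab => ?_⟩
    · have := h a b (by simp [ha]) (by simp [hb]) hab
      have ha' : a ∉ S := fun h => ha (hSU h)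
      have hb' : b ∉ S := fun h => hb (hSU h)
      simpa [ha', hb'] using this
    · have := h a b (by simp [ha]) (by simp [hb]) hab
      simp [ha, hb] at this
  · rintro ⟨h1, h2⟩ a b ha hb hab
    rw [Finset.mem_sdiff, not_and_not_right] at ha hb
    by_cases haS : a ∈ S <;> by_cases hbS : b ∈ S <;> simp only [haS, hbS, if_true, if_false]
    · exact absurd hab (h2 a haS b hbS)
    · exact (hn b).symm
    · exact hn a
    · exact h1 a b (fun h => haS (ha h)) (fun h => hbS (hb h)) hab

/-- Colouring a set of sinks with a fresh colour. -/
theorem countOn_sdiff {w : NCWord d} {n : ℕ+} (hn : ∀ a, w a ≠ n) {U S : Finset (Fin d)}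
    (hSU : S ⊆ U) (G : SimpleGraph (Fin d)) :
    countOn (U \ S) (fun a => if a ∈ S then n else w a) G =
      ∑ T ∈ U.powerset.filter (S ⊆ ·), countSinksOn U w T G := by
  have hstable : (∀ a ∈ S, ∀ b ∈ S, ¬ (restrictEdges G U).Adj a b) ↔
      ∀ a ∈ S, ∀ b ∈ S, ¬ G.Adj a b := by
    refine forall₂_congr fun a ha => forall₂_congr fun b hb => ?_
    simp [restrictEdges, hSU ha, hSU hb]
  simp only [countOn, countSinksOn, properOff_sdiff hn hSU]
  by_cases hw : ProperOff w U G
  · simp only [hw, true_and, if_true]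
    have hfib : ((acyclicOrientations (restrictEdges G U)).filter fun r => S ⊆ sinkSet r).card =
        ∑ T ∈ U.powerset.filter (S ⊆ ·),
          ((acyclicOrientations (restrictEdges G U)).filter fun r => U ∩ sinkSet r = T).card := by
      rw [Finset.card_eq_sum_card_fiberwise (f := fun r => U ∩ sinkSet r)
        (t := U.powerset.filter (S ⊆ ·))]
      · refine Finset.sum_congr rfl fun T hT => ?_
        rw [Finset.filter_filter]
        congr 1
        refine Finset.filter_congr fun r _ => ?_
        rw [Finset.mem_filter] at hT
        refine ⟨And.right, fun h => ⟨?_, h⟩⟩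
        rw [← h] at hT
        exact hT.2.trans Finset.inter_subset_right
      · intro r hr
        simp only [Finset.coe_filter, Set.mem_ofPred_eq] at hr ⊢
        exact ⟨Finset.mem_powerset.2 Finset.inter_subset_left, Finset.subset_inter hSU hr.2⟩
    rw [← Nat.cast_sum, ← hfib]
    split_ifs with hS
    · rw [card_filter_subset_sinkSet _ _ (hstable.2 hS), restrictEdges_restrictEdges_compl]
    · rw [card_filter_subset_sinkSet_eq_zero _ _ (fun h => hS (hstable.1 h)), Nat.cast_zero]
  · simp [hw]

theorem countSinksOn_mem {U : Finset (Fin d)}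
    (ih : ∀ U' ⊂ U, ∀ w : NCWord d, countOn U' w ∈ linearInvariants d) (w : NCWord d) :
    ∀ T : Finset (Fin d), T.Nonempty → T ⊆ U → countSinksOn U w T ∈ linearInvariants d := by
  obtain ⟨n, hn⟩ := exists_fresh w
  intro T
  induction hk : (U \ T).card using Nat.strong_induction_on generalizing T with
  | _ k ihT =>
    subst hk
    intro hT hTU
    have hstep : countSinksOn U w T = countOn (U \ T) (fun a => if a ∈ T then n else w a) -
        ∑ T' ∈ (U.powerset.filter (T ⊆ ·)).erase T, countSinksOn U w T' := by
      funext G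
      rw [Pi.sub_apply, Finset.sum_apply, countOn_sdiff hn hTU, eq_sub_iff_add_eq,
        Finset.add_sum_erase _ (fun T' => countSinksOn U w T' G)]
      simpa using hTU
    rw [hstep]
    refine Submodule.sub_mem _ (ih _ (Finset.sdiff_ssubset hTU hT) _)
      (Submodule.sum_mem _ fun T' hT' => ?_)
    rw [Finset.mem_erase, Finset.mem_filter, Finset.mem_powerset] at hT'
    obtain ⟨hne, hT'U, hTT'⟩ := hT'
    obtain ⟨x, hx, hxT⟩ := Finset.exists_of_ssubset (hTT'.ssubset_of_ne hne.symm)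
    refine ihT _ (Finset.card_lt_card ?_) T' rfl (hT.mono hTT') hT'U
    refine (Finset.ssubset_iff_of_subset (Finset.sdiff_subset_sdiff subset_rfl hTT')).2
      ⟨x, Finset.mem_sdiff.2 ⟨hT'U hx, hxT⟩, fun h => (Finset.mem_sdiff.1 h).2 hx⟩

theorem countOn_mem (U : Finset (Fin d)) : ∀ w, countOn U w ∈ linearInvariants d := by
  induction U using Finset.strongInduction with
  | H U ih =>
    intro w
    rcases U.eq_empty_or_nonempty with rfl | hU
    · refine mem_linearInvariants.2 ⟨LinearMap.proj w, fun G => ?_⟩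
      simp [countOn, restrictEdges_empty, acyclicOrientations_bot, YG, ProperOff]
    · have hsum : countOn U w = ∑ T ∈ U.powerset.filter Finset.Nonempty, countSinksOn U w T := by
        funext G
        simp only [Finset.sum_apply, countOn, countSinksOn]
        by_cases hw : ProperOff w U G
        · simp only [hw, if_true]
          rw [← Nat.cast_sum, ← Finset.card_eq_sum_card_fiberwise]
          intro r hr
          obtain ⟨x, hx, hxs⟩ := (mem_acyclicOrientations.1 hr).exists_mem_sinkSet hU
            (fun x _ y h => h.2.2)
          simp only [Finset.coe_filter, Set.mem_ofPred_eq]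
          exact ⟨Finset.mem_powerset.2 Finset.inter_subset_left, x, Finset.mem_inter.2 ⟨hx, hxs⟩⟩
        · simp [hw]
      rw [hsum]
      refine Submodule.sum_mem _ fun T hT => ?_
      rw [Finset.mem_filter, Finset.mem_powerset] at hT
      exact countSinksOn_mem ih w T hT.2 hT.1

/-- The number of acyclic orientations with exactly `j` sinks, one of which is `v`. -/
def sinkCount (v : Fin d) (j : ℕ) (G : SimpleGraph (Fin d)) : ℚ :=
  ((acyclicOrientations G).filter fun r => (sinkSet r).card = j ∧ v ∈ sinkSet r).card

theorem sinkCount_mem (v : Fin d) (j : ℕ) : sinkCount v j ∈ linearInvariants d := by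
  have hsum : sinkCount v j =
      ∑ T ∈ Finset.univ.filter (fun T : Finset (Fin d) => T.card = j ∧ v ∈ T),
        countSinksOn Finset.univ (fun _ => 1) T := by
    funext G
    have hw : ProperOff (fun _ => 1) Finset.univ G := fun a _ ha => absurd (Finset.mem_univ a) ha
    simp only [Finset.sum_apply, countSinksOn, sinkCount, hw, if_true, restrictEdges_univ,
      Finset.univ_inter]
    rw [← Nat.cast_sum, Finset.card_eq_sum_card_fiberwise (f := fun r => sinkSet r)
      (t := Finset.univ.filter (fun T : Finset (Fin d) => T.card = j ∧ v ∈ T))]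
    · congr 1
      refine Finset.sum_congr rfl fun T hT => ?_
      rw [Finset.filter_filter]
      congr 1
      refine Finset.filter_congr fun r _ => ⟨And.right, fun h => ⟨?_, h⟩⟩
      rw [h]
      exact (Finset.mem_filter.1 hT).2
    · intro r hr
      simpa using (Finset.mem_filter.1 hr).2
  rw [hsum]
  refine Submodule.sum_mem _ fun T hT => ?_
  exact countSinksOn_mem (fun U' _ => countOn_mem U') _ T ⟨v, (Finset.mem_filter.1 hT).2.2⟩
    (Finset.subset_univ T)

end LinearInvariants

section Cliques

variable {d : ℕ}

/-- The disjoint union of the complete graphs on the blocks of `π`. -/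
def blockGraph (π : SetPtn d) : SimpleGraph (Fin d) where
  Adj a b := a ≠ b ∧ sameBlock π a b
  symm := ⟨fun _ _ h => ⟨h.1.symm, let ⟨B, hB, ha, hb⟩ := h.2; ⟨B, hB, hb, ha⟩⟩⟩
  loopless := ⟨fun _ h => h.1 rfl⟩

theorem eSP_eq_YG (π : SetPtn d) : eSP π = YG (blockGraph π) := by
  funext w
  simp [eSP, YG, blockGraph]

theorem mem_of_sameBlock {π : SetPtn d} {a b : Fin d} {B : Finset (Fin d)} (hB : B ∈ π.parts)
    (ha : a ∈ B) (h : sameBlock π a b) : b ∈ B := by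
  obtain ⟨C, hC, haC, hbC⟩ := h
  rwa [π.eq_of_mem_parts hB hC ha haC]

/-- An acyclic orientation of a disjoint union of cliques has exactly one sink in each clique. -/
theorem existsUnique_sink_mem_block (π : SetPtn d) (U : Finset (Fin d)) {r : Fin d → Fin d → Prop}
    (hr : IsAcyclicOrientation (restrictEdges (blockGraph π) U) r) {B : Finset (Fin d)}
    (hB : B ∈ π.parts) (hBU : (B ∩ U).Nonempty) : ∃! x, x ∈ B ∩ U ∧ x ∈ sinkSet r := by
  obtain ⟨x, hx, hxs⟩ := hr.exists_mem_sinkSet hBU (fun x hx y hxy =>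
    Finset.mem_inter.2 ⟨mem_of_sameBlock hB (Finset.mem_inter.1 hx).1 hxy.1.2, hxy.2.2⟩)
  refine ⟨x, ⟨hx, hxs⟩, fun y ⟨hy, hys⟩ => ?_⟩
  by_contra hne
  rw [Finset.mem_inter] at hx hy
  have hadj : (restrictEdges (blockGraph π) U).Adj y x :=
    ⟨⟨hne, B, hB, hy.1, hx.1⟩, hy.2, hx.2⟩
  rcases hr.rel_or_rel hadj with h | h
  · exact mem_sinkSet.1 hys _ h
  · exact mem_sinkSet.1 hxs _ h

theorem card_filter_mem_sinkSet (G : SimpleGraph (Fin d)) (U : Finset (Fin d)) (u : Fin d) :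
    ((acyclicOrientations (restrictEdges G U)).filter fun r => u ∈ sinkSet r).card =
      (acyclicOrientations (restrictEdges G (U.erase u))).card := by
  have := card_filter_subset_sinkSet (restrictEdges G U) {u} (by simp)
  rwa [restrictEdges_restrictEdges_compl, Finset.sdiff_singleton_eq_erase,
    Finset.filter_congr fun r _ => Finset.singleton_subset_iff] at this

theorem card_acyclicOrientations_blockGraph (π : SetPtn d) (U : Finset (Fin d)) :
    (acyclicOrientations (restrictEdges (blockGraph π) U)).card =
      ∏ B ∈ π.parts, (B ∩ U).card.factorial := by
  induction U using Finset.strongInduction with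
  | H U ih =>
    rcases U.eq_empty_or_nonempty with rfl | ⟨u, hu⟩
    · simp [restrictEdges_empty, acyclicOrientations_bot]
    · obtain ⟨B, hB, huB⟩ := π.exists_mem (Finset.mem_univ u)
      have hBU : (B ∩ U).Nonempty := ⟨u, Finset.mem_inter.2 ⟨huB, hu⟩⟩
      have hsplit : (acyclicOrientations (restrictEdges (blockGraph π) U)).card =
          ∑ x ∈ B ∩ U, ((acyclicOrientations (restrictEdges (blockGraph π) U)).filter
            fun r => x ∈ sinkSet r).card := by
        simp only [Finset.card_filter]
        rw [Finset.sum_comm, Finset.card_eq_sum_ones]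
        refine Finset.sum_congr rfl fun r hr => ?_
        obtain ⟨x, hx, huniq⟩ := existsUnique_sink_mem_block π U (mem_acyclicOrientations.1 hr) hB hBU
        rw [← Finset.card_filter, eq_comm, Finset.card_eq_one]
        refine ⟨x, ?_⟩
        ext y
        rw [Finset.mem_filter, Finset.mem_singleton]
        exact ⟨huniq y, fun h => h ▸ hx⟩
      rw [hsplit, ← Finset.mul_prod_erase _ _ hB, ← Nat.mul_factorial_pred hBU.card_pos.ne',
        mul_assoc, ← smul_eq_mul (B ∩ U).card, ← Finset.sum_const]
      refine Finset.sum_congr rfl fun x hx => ?_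
      rw [Finset.mem_inter] at hx
      rw [card_filter_mem_sinkSet, ih _ (Finset.erase_ssubset hx.2), ← Finset.mul_prod_erase _ _ hB,
        Finset.inter_erase, Finset.card_erase_of_mem (Finset.mem_inter.2 hx)]
      congr 1
      refine Finset.prod_congr rfl fun C hC => ?_
      rw [Finset.mem_erase] at hC
      have hxC : x ∉ C ∩ U := fun h =>
        hC.1 (π.eq_of_mem_parts hC.2 hB (Finset.mem_inter.1 h).1 hx.1)
      rw [Finset.inter_erase, Finset.erase_eq_of_notMem hxC]

theorem card_sinkSet_blockGraph (π : SetPtn d) {r : Fin d → Fin d → Prop}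
    (hr : IsAcyclicOrientation (blockGraph π) r) : (sinkSet r).card = π.parts.card := by
  rw [← restrictEdges_univ (blockGraph π)] at hr
  have hex := fun (B : Finset (Fin d)) (hB : B ∈ π.parts) =>
    existsUnique_sink_mem_block π Finset.univ hr hB (by simpa using π.nonempty_of_mem_parts hB)
  simp only [Finset.inter_univ] at hex
  refine Finset.card_bij (fun x _ => π.part x) (fun x _ => π.part_mem.2 (Finset.mem_univ x)) ?_ ?_
  · intro x hx y hy hxy
    refine (hex (π.part x) (π.part_mem.2 (Finset.mem_univ x))).unique
      ⟨π.mem_part (Finset.mem_univ x), hx⟩ ⟨?_, hy⟩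
    rw [hxy]
    exact π.mem_part (Finset.mem_univ y)
  · intro B hB
    obtain ⟨x, hx, _⟩ := hex B hB
    exact ⟨x, hx.2, π.part_eq_of_mem hB hx.1⟩

theorem blockOf_mem_parts (π : SetPtn d) (a : Fin d) : blockOf π a ∈ π.parts := by
  obtain ⟨B, hB, ha⟩ := π.exists_mem (Finset.mem_univ a)
  have : blockOf π a = B := by
    ext k
    simp only [blockOf, Finset.mem_filter, Finset.mem_univ, true_and]
    exact ⟨mem_of_sameBlock hB ha, fun hk => ⟨B, hB, ha, hk⟩⟩
  rwa [this]

theorem mem_blockOf (π : SetPtn d) (a : Fin d) : a ∈ blockOf π a := by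
  obtain ⟨B, hB, ha⟩ := π.exists_mem (Finset.mem_univ a)
  simp only [blockOf, Finset.mem_filter, Finset.mem_univ, true_and]
  exact ⟨B, hB, ha, ha⟩

theorem ptype_fst_card (π : SetPtn d) (a : Fin d) :
    (ptype π a).1.card + 1 = π.parts.card := by
  simp only [ptype, Multiset.card_map]
  exact Finset.card_erase_add_one (blockOf_mem_parts π a)

theorem sinkCount_blockGraph (π : SetPtn d) (v : Fin d) (j : ℕ) :
    sinkCount v j (blockGraph π) = if (ptype π v).1.card + 1 = j then
      (((ptype π v).1.map Nat.factorial).prod : ℚ) * (Nat.factorial ((ptype π v).2 - 1) : ℚ)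
      else 0 := by
  rw [ptype_fst_card, sinkCount]
  split_ifs with hj
  · have h1 : ((acyclicOrientations (blockGraph π)).filter
        fun r => (sinkSet r).card = j ∧ v ∈ sinkSet r) =
        (acyclicOrientations (blockGraph π)).filter fun r => v ∈ sinkSet r := by
      refine Finset.filter_congr fun r hr => and_iff_right ?_
      rw [card_sinkSet_blockGraph π (mem_acyclicOrientations.1 hr), hj]
    have h2 := card_filter_mem_sinkSet (blockGraph π) Finset.univ v
    rw [restrictEdges_univ] at h2
    rw [h1, h2, card_acyclicOrientations_blockGraph,
      ← Finset.mul_prod_erase _ _ (blockOf_mem_parts π v), Finset.inter_erase, Finset.inter_univ,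
      Finset.card_erase_of_mem (mem_blockOf π v), mul_comm, Nat.cast_mul]
    congr 2
    simp only [ptype, Multiset.map_map]
    refine Finset.prod_congr rfl fun C hC => ?_
    rw [Finset.mem_erase] at hC
    have hv : v ∉ C := fun h =>
      hC.1 (π.eq_of_mem_parts hC.2 (blockOf_mem_parts π v) h (mem_blockOf π v))
    rw [Finset.inter_erase, Finset.inter_univ, Finset.erase_eq_of_notMem hv, Function.comp_apply]
  · rw [Nat.cast_eq_zero, Finset.card_eq_zero, Finset.filter_eq_empty_iff]
    rintro r hr ⟨h, _⟩
    exact hj ((card_sinkSet_blockGraph π (mem_acyclicOrientations.1 hr)).symm.trans h)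

end Cliques

theorem stmt18 (d : ℕ) (hd : 0 < d) (G : SimpleGraph (Fin d))
    (s : Finset (SetPtn d)) (c : SetPtn d → ℚ)
    (hdistinct : ∀ π₁ ∈ s, ∀ π₂ ∈ s,
      ptype π₁ (⟨d - 1, by omega⟩ : Fin d) = ptype π₂ (⟨d - 1, by omega⟩ : Fin d) → π₁ = π₂)
    (hdecomp : YG G - ∑ π ∈ s, c π • eSP π ∈ Ksub (⟨d - 1, by omega⟩ : Fin d)) :
    ∀ j : ℕ, 1 ≤ j →
      (Nat.card {r : Fin d → Fin d → Prop //
          IsAcyclicOrientation G r ∧ (sinkSet r).card = j ∧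
          (⟨d - 1, by omega⟩ : Fin d) ∈ sinkSet r} : ℚ) =
        ∑ π ∈ s.filter
            (fun π => (ptype π (⟨d - 1, by omega⟩ : Fin d)).1.card + 1 = j),
          c π * (((ptype π (⟨d - 1, by omega⟩ : Fin d)).1.map Nat.factorial).prod : ℚ) *
            (Nat.factorial ((ptype π (⟨d - 1, by omega⟩ : Fin d)).2 - 1) : ℚ) := by
  intro j _
  obtain ⟨L, hL⟩ := mem_linearInvariants.1 (sinkCount_mem (⟨d - 1, by omega⟩ : Fin d) j)
  have hLe : ∀ π : SetPtn d, L (eSP π) = _ := fun π =>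
    (congrArg L (eSP_eq_YG π)).trans ((hL _).trans (sinkCount_blockGraph π _ j))
  have hK : ∀ f ∈ Ksub (⟨d - 1, by omega⟩ : Fin d), L f = 0 := by
    intro f hf
    refine (Submodule.span_le (p := LinearMap.ker L)).2 ?_ hf
    rintro _ ⟨π₁, π₂, hπ, rfl⟩
    rw [SetLike.mem_coe, LinearMap.mem_ker, map_sub, hLe, hLe, hπ, sub_self]
  have hY := hK _ hdecomp
  rw [map_sub, sub_eq_zero, hL, map_sum] at hY
  have hcard : (Nat.card {r : Fin d → Fin d → Prop //
      IsAcyclicOrientation G r ∧ (sinkSet r).card = j ∧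
      (⟨d - 1, by omega⟩ : Fin d) ∈ sinkSet r} : ℚ) = sinkCount (⟨d - 1, by omega⟩ : Fin d) j G := by
    rw [sinkCount, acyclicOrientations, Finset.filter_filter, Nat.card_eq_fintype_card,
      Fintype.card_subtype]
  rw [hcard, hY, Finset.sum_filter]
  refine Finset.sum_congr rfl fun π _ => ?_
  rw [map_smul, hLe, smul_eq_mul]
  split_ifs
  · rw [mul_assoc]
  · rw [mul_zero]
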